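/- arXiv:0906.3652 — 2 statements merged into one kernel-verified Lean document; each statement's English description precedes it below -/
import Mathlib

section
/- A bivariate local central limit theorem holds for the joint distribution of the number of dimers and the total number of dimers and single points: for all C > 0, A > 0 and ε > 0 there exists N₀ such that for all integers N ≥ N₀ and all integers s, k for which x := (s - (2/9)N)/(√(6N)/9) ∈ (-C, C) and y := (k - (2/3)N)/(√(2N)/3) ∈ (-A, A), one has | J_N(s,k) · 2π · (√(6N)/9) · (√(2N)/3) · √(2/3) · exp( (3/4)·( x² + (2√3/3)·x·y + y² ) ) - 1 | < ε, where J_N(s,k) := C(k, s) · C(N-k-1, s-1) · (2/3)^{k-1} · (1/3)^{N-k}. The limiting density is a bivariate Gaussian with correlation coefficient ρ = -1/√3. -/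
/-- `J_N(s,k)`: the joint probability that the number of dimers equals `s` and
the total number of dimers and single points equals `k`. -/
noncomputable def jointProb (N s k : ℕ) : ℝ :=
  (k.choose s : ℝ) * ((N - k - 1).choose (s - 1) : ℝ)
    * (2 / 3 : ℝ) ^ (k - 1) * (1 / 3 : ℝ) ^ (N - k)

open Filter Topology Asymptotics Stirling

/-- Second-order expansion of `(1 + u) log (1 + u)` at `0`. -/
lemma abs_one_add_mul_log_one_add_sub_le {u : ℝ} (hu : |u| ≤ 1 / 2) :
    |(1 + u) * Real.log (1 + u) - u - u ^ 2 / 2| ≤ 4 * |u| ^ 3 := by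
  have h := Real.abs_log_sub_add_sum_range_le (x := -u) (by rw [abs_neg]; linarith) 2
  simp only [Finset.sum_range_succ, Finset.sum_range_zero, abs_neg, sub_neg_eq_add] at h
  norm_num at h
  set E := -u + u ^ 2 / 2 + Real.log (1 + u) with hE
  have h2 : |E| ≤ 2 * |u| ^ 3 := by
    refine h.trans ?_
    rw [div_le_iff₀ (by linarith)]
    nlinarith [pow_nonneg (abs_nonneg u) 3]
  have h3 : (1 + u) * Real.log (1 + u) - u - u ^ 2 / 2 = -(u ^ 3 / 2) + (1 + u) * E := by
    rw [hE]; ring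
  rw [h3]
  have h4 : |1 + u| ≤ 3 / 2 := (abs_add_le 1 u).trans (by rw [abs_one]; linarith)
  calc |-(u ^ 3 / 2) + (1 + u) * E| ≤ |-(u ^ 3 / 2)| + |(1 + u) * E| := abs_add_le _ _
    _ = |u| ^ 3 / 2 + |1 + u| * |E| := by rw [abs_neg, abs_div, abs_pow, abs_mul]; norm_num
    _ ≤ |u| ^ 3 / 2 + 3 / 2 * (2 * |u| ^ 3) := by gcongr
    _ ≤ 4 * |u| ^ 3 := by linarith [pow_nonneg (abs_nonneg u) 3]

section

variable {ι : Type*} {L : Filter ι}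

lemma tendsto_div_zero_of_isBigO_sqrt {d t : ι → ℝ} (ht : Tendsto t L atTop)
    (hd : d =O[L] fun i => √(t i)) : Tendsto (fun i => d i / t i) L (𝓝 0) := by
  have h1 : (fun i => d i / t i) =O[L] fun i => √(t i) / t i :=
    hd.mul (isBigO_refl (fun i => (t i)⁻¹) L)
  refine h1.trans_tendsto ?_
  simp_rw [Real.sqrt_div_self', one_div]
  exact (Real.tendsto_sqrt_atTop.comp ht).inv_tendsto_atTop

lemma tendsto_div_of_isBigO_sqrt {x t : ι → ℝ} (ht : Tendsto t L atTop)
    (hx : (fun i => x i - t i) =O[L] fun i => √(t i)) :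
    Tendsto (fun i => x i / t i) L (𝓝 1) := by
  have h := (tendsto_div_zero_of_isBigO_sqrt ht hx).const_add 1
  rw [add_zero] at h
  refine h.congr' ?_
  filter_upwards [ht.eventually_gt_atTop 0] with i hi
  field_simp
  ring

lemma tendsto_atTop_of_isBigO_sqrt {x t : ι → ℝ} (ht : Tendsto t L atTop)
    (hx : (fun i => x i - t i) =O[L] fun i => √(t i)) : Tendsto x L atTop := by
  refine ((tendsto_div_of_isBigO_sqrt ht hx).pos_mul_atTop one_pos ht).congr' ?_
  filter_upwards [ht.eventually_gt_atTop 0] with i hi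
  field_simp

lemma tendsto_mul_log_div_sub_sub {x t : ι → ℝ} (ht : Tendsto t L atTop)
    (hx : (fun i => x i - t i) =O[L] fun i => √(t i)) :
    Tendsto (fun i => x i * Real.log (x i / t i) - (x i - t i) - (x i - t i) ^ 2 / (2 * t i))
      L (𝓝 0) := by
  have h0 := tendsto_div_zero_of_isBigO_sqrt ht hx
  have h1 : (fun i => x i * Real.log (x i / t i) - (x i - t i) - (x i - t i) ^ 2 / (2 * t i))
      =O[L] fun i => t i * ((x i - t i) / t i) ^ 3 := by
    refine IsBigO.of_bound 4 ?_
    have hs : ∀ᶠ i in L, |(x i - t i) / t i| ≤ 1 / 2 := by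
      have := h0.abs
      rw [abs_zero] at this
      exact this.eventually_le_const (by norm_num)
    filter_upwards [ht.eventually_gt_atTop 0, hs] with i hi hu
    have h := abs_one_add_mul_log_one_add_sub_le hu
    set u := (x i - t i) / t i with hu'
    have hxi : x i = t i * (1 + u) := by rw [hu']; field_simp; ring
    have e : x i * Real.log (x i / t i) - (x i - t i) - (x i - t i) ^ 2 / (2 * t i)
        = t i * ((1 + u) * Real.log (1 + u) - u - u ^ 2 / 2) := by
      have : x i / t i = 1 + u := by rw [hxi]; field_simp
      rw [this, hxi]
      field_simp
      ring
    rw [e, norm_mul, norm_mul, norm_pow, Real.norm_eq_abs, Real.norm_eq_abs, Real.norm_eq_abs]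
    nlinarith [abs_nonneg (t i)]
  have h2 : (fun i => t i * ((x i - t i) / t i) ^ 3) =O[L] fun i => (√(t i))⁻¹ := by
    have h3 : (fun i => (x i - t i) ^ 3 * ((t i) ^ 2)⁻¹)
        =O[L] fun i => √(t i) ^ 3 * ((t i) ^ 2)⁻¹ := (hx.pow 3).mul (isBigO_refl _ _)
    refine h3.congr' ?_ ?_
    · filter_upwards [ht.eventually_gt_atTop 0] with i hi
      field_simp
    · filter_upwards [ht.eventually_gt_atTop 0] with i hi
      have := Real.sqrt_pos.2 hi
      have h4 : t i = √(t i) ^ 2 := (Real.sq_sqrt hi.le).symm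
      rw [show (t i) ^ 2 = (√(t i) ^ 2) ^ 2 by rw [← h4]]
      field_simp
  exact (h1.trans h2).trans_tendsto (Real.tendsto_sqrt_atTop.comp ht).inv_tendsto_atTop

lemma factorial_eq_stirlingSeq_mul {n : ℕ} (hn : 0 < n) :
    (n.factorial : ℝ) = stirlingSeq n * √(2 * n) * Real.exp (n * Real.log n - n) := by
  have h : (0 : ℝ) < n := by exact_mod_cast hn
  have e : Real.exp (n * Real.log n - n) = (n / Real.exp 1) ^ n := by
    rw [div_pow, Real.exp_sub, mul_comm, Real.exp_mul, Real.exp_log h, Real.rpow_natCast,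
      ← Real.exp_nat_mul, mul_one]
  rw [e, stirlingSeq]
  have : (0 : ℝ) < √(2 * n) := by positivity
  field_simp

lemma binomial_mul_gaussian_eq {p : ℝ} (hp : 0 < p) (hp1 : p < 1) {j r : ℕ} (hj : 0 < j)
    (hr : 0 < r) {n : ℕ} (hn : n = j + r) :
    (n.choose j : ℝ) * p ^ j * (1 - p) ^ r * √(2 * Real.pi * n * p * (1 - p))
        * Real.exp ((j - n * p) ^ 2 / (2 * n * p * (1 - p)))
      = √Real.pi * stirlingSeq n / (stirlingSeq j * stirlingSeq r)
        * √((j / (n * p))⁻¹ * (r / (n * (1 - p)))⁻¹)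
        * Real.exp (-((j * Real.log (j / (n * p)) - (j - n * p) - (j - n * p) ^ 2 / (2 * (n * p)))
          + (r * Real.log (r / (n * (1 - p))) - (r - n * (1 - p))
            - (r - n * (1 - p)) ^ 2 / (2 * (n * (1 - p)))))) := by
  have hq : 0 < 1 - p := by linarith
  have hj' : (0 : ℝ) < j := by exact_mod_cast hj
  have hr' : (0 : ℝ) < r := by exact_mod_cast hr
  have hnr : (n : ℝ) = j + r := by exact_mod_cast hn
  have hn' : (0 : ℝ) < n := by linarith
  have hchoose : (n.choose j : ℝ) = n.factorial / (j.factorial * r.factorial) := by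
    subst hn
    rw [Nat.cast_add_choose]
  have hS : ∀ {m : ℕ}, 0 < m → 0 < stirlingSeq m := fun {m} hm => by
    obtain ⟨m, rfl⟩ := Nat.exists_eq_succ_of_ne_zero hm.ne'
    exact stirlingSeq'_pos m
  have hSj := hS hj
  have hSr := hS hr
  have hpj : p ^ j = Real.exp (j * Real.log p) := by
    rw [mul_comm, Real.exp_mul, Real.exp_log hp, Real.rpow_natCast]
  have hqr : (1 - p) ^ r = Real.exp (r * Real.log (1 - p)) := by
    rw [mul_comm, Real.exp_mul, Real.exp_log hq, Real.rpow_natCast]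
  rw [hchoose, factorial_eq_stirlingSeq_mul hj, factorial_eq_stirlingSeq_mul hr,
    factorial_eq_stirlingSeq_mul (n := n) (by omega), hpj, hqr]
  have hsq : √(2 * Real.pi * n * p * (1 - p)) * √(2 * n)
      = √Real.pi * √((j / (n * p))⁻¹ * (r / (n * (1 - p)))⁻¹) * (√(2 * j) * √(2 * r)) := by
    have hpi := Real.pi_pos
    rw [← Real.sqrt_mul (by positivity), ← Real.sqrt_mul (by positivity),
      ← Real.sqrt_mul (by positivity), ← Real.sqrt_mul (by positivity)]
    congr 1
    field_simp
  have hexp : Real.exp (n * Real.log n - n) * Real.exp (j * Real.log p)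
        * Real.exp (r * Real.log (1 - p)) * Real.exp ((j - n * p) ^ 2 / (2 * n * p * (1 - p)))
      = Real.exp (-((j * Real.log (j / (n * p)) - (j - n * p) - (j - n * p) ^ 2 / (2 * (n * p)))
          + (r * Real.log (r / (n * (1 - p))) - (r - n * (1 - p))
            - (r - n * (1 - p)) ^ 2 / (2 * (n * (1 - p))))))
        * (Real.exp (j * Real.log j - j) * Real.exp (r * Real.log r - r)) := by
    simp only [← Real.exp_add]
    congr 1
    rw [Real.log_div hj'.ne' (by positivity), Real.log_div hr'.ne' (by positivity),
      Real.log_mul hn'.ne' hp.ne', Real.log_mul hn'.ne' hq.ne']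
    have hd : (r : ℝ) - n * (1 - p) = -(j - n * p) := by rw [hnr]; ring
    have hs : (j - n * p) ^ 2 / (2 * n * p * (1 - p))
        = (j - n * p) ^ 2 / (2 * (n * p)) + (j - n * p) ^ 2 / (2 * (n * (1 - p))) := by
      field_simp
      ring
    rw [hd, hs, neg_sq]
    generalize (j - n * p) ^ 2 / (2 * (n * p)) = a
    generalize (j - n * p) ^ 2 / (2 * (n * (1 - p))) = b
    generalize Real.log n = l
    rw [hnr]
    ring
  have h1 : (0 : ℝ) < √(2 * j) := by positivity
  have h2 : (0 : ℝ) < √(2 * r) := by positivity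
  calc _ = stirlingSeq n / (stirlingSeq j * stirlingSeq r)
        * ((√(2 * Real.pi * n * p * (1 - p)) * √(2 * n)) / (√(2 * j) * √(2 * r)))
        * ((Real.exp (n * Real.log n - n) * Real.exp (j * Real.log p)
        * Real.exp (r * Real.log (1 - p)) * Real.exp ((j - n * p) ^ 2 / (2 * n * p * (1 - p))))
          / (Real.exp (j * Real.log j - j) * Real.exp (r * Real.log r - r))) := by
        field_simp
    _ = _ := by
        rw [hsq, hexp, mul_div_assoc, div_self (by positivity), mul_div_assoc,
          div_self (by positivity)]
        ring

/-- Local de Moivre–Laplace theorem along a filter. -/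
theorem tendsto_binomial_mul_gaussian {p : ℝ} (hp : 0 < p) (hp1 : p < 1) {n j : ι → ℕ}
    (hn : Tendsto n L atTop) (hj : (fun i => (j i : ℝ) - n i * p) =O[L] fun i => √(n i : ℝ)) :
    Tendsto (fun i => ((n i).choose (j i) : ℝ) * p ^ j i * (1 - p) ^ (n i - j i)
        * √(2 * Real.pi * n i * p * (1 - p))
        * Real.exp ((j i - n i * p) ^ 2 / (2 * n i * p * (1 - p)))) L (𝓝 1) := by
  have hq : 0 < 1 - p := by linarith
  have hnR : Tendsto (fun i => (n i : ℝ)) L atTop := tendsto_natCast_atTop_atTop.comp hn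
  have hscale : ∀ c : ℝ, 0 < c → (fun i => √(n i : ℝ)) =O[L] fun i => √(n i * c) := by
    intro c hc
    refine IsBigO.of_bound (√c)⁻¹ (Eventually.of_forall fun i => le_of_eq ?_)
    have := Real.sqrt_pos.2 hc
    rw [Real.sqrt_mul (by positivity), norm_mul, Real.norm_eq_abs (√c), abs_of_pos this]
    field_simp
  have ht1 : Tendsto (fun i => n i * p) L atTop := hnR.atTop_mul_const hp
  have ht2 : Tendsto (fun i => n i * (1 - p)) L atTop := hnR.atTop_mul_const hq
  have hj1 := hj.trans (hscale p hp)
  have hle : ∀ᶠ i in L, j i < n i := by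
    have h := (tendsto_div_of_isBigO_sqrt ht1 hj1).mul_const p
    rw [one_mul] at h
    filter_upwards [h.eventually_lt_const hp1, hnR.eventually_gt_atTop 0] with i hi hi0
    have : (j i : ℝ) / (n i * p) * p = j i / n i := by field_simp
    rw [this, div_lt_one hi0] at hi
    exact_mod_cast hi
  have hr2 : (fun i => ((n i - j i : ℕ) : ℝ) - n i * (1 - p)) =O[L]
      fun i => √(n i * (1 - p)) := by
    refine (hj.neg_left.trans (hscale _ hq)).congr' ?_ EventuallyEq.rfl
    filter_upwards [hle] with i hi
    rw [Nat.cast_sub hi.le]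
    ring
  have hjT : Tendsto j L atTop :=
    tendsto_natCast_atTop_iff.1 (tendsto_atTop_of_isBigO_sqrt ht1 hj1)
  have hrT : Tendsto (fun i => n i - j i) L atTop :=
    tendsto_natCast_atTop_iff.1 (tendsto_atTop_of_isBigO_sqrt ht2 hr2)
  have hpi : √Real.pi ≠ 0 := (Real.sqrt_pos.2 Real.pi_pos).ne'
  have hS := (((tendsto_stirlingSeq_sqrt_pi.comp hn).const_mul √Real.pi).div
    ((tendsto_stirlingSeq_sqrt_pi.comp hjT).mul (tendsto_stirlingSeq_sqrt_pi.comp hrT))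
    (mul_ne_zero hpi hpi))
  have hQ := (((tendsto_div_of_isBigO_sqrt ht1 hj1).inv₀ one_ne_zero).mul
    ((tendsto_div_of_isBigO_sqrt ht2 hr2).inv₀ one_ne_zero)).sqrt
  have hE := (Real.continuous_exp.tendsto _).comp
    ((tendsto_mul_log_div_sub_sub ht1 hj1).add (tendsto_mul_log_div_sub_sub ht2 hr2)).neg
  have h := (hS.mul hQ).mul hE
  rw [div_self (mul_ne_zero hpi hpi)] at h
  simp only [inv_one, mul_one, Real.sqrt_one, add_zero, neg_zero, Real.exp_zero] at h
  refine h.congr' ?_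
  filter_upwards [hle, hjT.eventually_gt_atTop 0] with i hi hi0
  exact (binomial_mul_gaussian_eq hp hp1 hi0 (Nat.sub_pos_of_lt hi)
    (Nat.add_sub_of_le hi.le).symm).symm

lemma tendsto_div_of_sub_mul_isBigO_sqrt {x t : ι → ℝ} {c : ℝ} (ht : Tendsto t L atTop)
    (hx : (fun i => x i - c * t i) =O[L] fun i => √(t i)) :
    Tendsto (fun i => x i / t i) L (𝓝 c) := by
  have h := (tendsto_div_zero_of_isBigO_sqrt ht hx).const_add c
  rw [add_zero] at h
  refine h.congr' ?_
  filter_upwards [ht.eventually_gt_atTop 0] with i hi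
  field_simp
  ring

lemma tendsto_sq_div_mul_zero {d t g : ι → ℝ} (ht : Tendsto t L atTop)
    (hd : d =O[L] fun i => √(t i)) (hg : Tendsto g L (𝓝 0)) :
    Tendsto (fun i => d i ^ 2 / t i * g i) L (𝓝 0) := by
  have h1 : (fun i => d i ^ 2 / t i) =O[L] fun _ => (1 : ℝ) := by
    have h2 : (fun i => d i ^ 2 / t i) =O[L] fun i => √(t i) ^ 2 / t i :=
      (hd.pow 2).mul (isBigO_refl (fun i => (t i)⁻¹) L)
    refine h2.congr' EventuallyEq.rfl ?_
    filter_upwards [ht.eventually_gt_atTop 0] with i hi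
    rw [Real.sq_sqrt hi.le, div_self hi.ne']
  have h3 := h1.mul_isLittleO ((isLittleO_one_iff ℝ).2 hg)
  simp only [mul_one] at h3
  exact (isLittleO_one_iff ℝ).1 h3

lemma isBigO_sqrt_of_tendsto_div {t u : ι → ℝ} {c : ℝ} (hc : 0 < c) (ht : Tendsto t L atTop)
    (hu : Tendsto (fun i => u i / t i) L (𝓝 c)) :
    (fun i => √(t i)) =O[L] fun i => √(u i) := by
  refine IsBigO.of_bound (√(c / 2))⁻¹ ?_
  filter_upwards [ht.eventually_gt_atTop 0, hu.eventually_const_lt (half_lt_self hc)] with i hi hi2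
  rw [lt_div_iff₀ hi] at hi2
  have hc2 : 0 < √(c / 2) := Real.sqrt_pos.2 (half_pos hc)
  rw [Real.norm_of_nonneg (Real.sqrt_nonneg _), Real.norm_of_nonneg (Real.sqrt_nonneg _),
    inv_mul_eq_div, le_div_iff₀ hc2, mul_comm, ← Real.sqrt_mul (half_pos hc).le]
  exact Real.sqrt_le_sqrt hi2.le

end

lemma jointProb_eq_mul_binomial {N s k m : ℕ} (hs : 0 < s) (hsk : s < k) (hsm : s < m)
    (hN : N = k + m) :
    jointProb N s k = 3 / 2 * (s / m)
      * ((k.choose s : ℝ) * (1 / 3) ^ s * (1 - 1 / 3) ^ (k - s))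
      * ((m.choose s : ℝ) * (2 / 3) ^ s * (1 - 2 / 3) ^ (m - s)) := by
  obtain ⟨a, rfl⟩ := Nat.exists_eq_add_of_lt hsk
  obtain ⟨b, rfl⟩ := Nat.exists_eq_add_of_lt hsm
  obtain ⟨s, rfl⟩ := Nat.exists_eq_succ_of_ne_zero hs.ne'
  have h := Nat.add_one_mul_choose_eq (s + 1 + b) s
  have h' : ((s + 1 + b + 1 : ℕ) : ℝ) * ((s + 1 + b).choose s : ℝ)
      = ((s + 1 + b + 1).choose (s + 1) : ℝ) * ((s + 1 : ℕ) : ℝ) := by exact_mod_cast h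
  have h0 : ((s + 1 + b + 1 : ℕ) : ℝ) ≠ 0 := by positivity
  have hch : ((s + 1 + b).choose s : ℝ)
      = ((s + 1 + b + 1).choose (s + 1) : ℝ) * ((s + 1 : ℕ) : ℝ) / ((s + 1 + b + 1 : ℕ) : ℝ) := by
    rw [eq_div_iff h0, ← h', mul_comm]
  have e1 : N - (s.succ + a + 1) = s + 1 + b + 1 := by omega
  have e2 : s.succ + a + 1 - 1 = s + 1 + a := by omega
  have e3 : s.succ + a + 1 - s.succ = a + 1 := by omega
  have e4 : s.succ + b + 1 - s.succ = b + 1 := by omega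
  rw [jointProb, e1, e2, e3, e4, Nat.add_sub_cancel, Nat.succ_sub_one, hch]
  norm_num [Nat.succ_eq_add_one]
  ring

lemma gaussian_exponent_eq {N s k m : ℝ} (hN : 0 < N) (hm : m = N - k) :
    3 / 4 * (((s - 2 / 9 * N) / (√(6 * N) / 9)) ^ 2
        + 2 * √3 / 3 * ((s - 2 / 9 * N) / (√(6 * N) / 9)) * ((k - 2 / 3 * N) / (√(2 * N) / 3))
        + ((k - 2 / 3 * N) / (√(2 * N) / 3)) ^ 2)
      = 27 / 8 * ((s - k * (1 / 3)) ^ 2 / N) + 27 / 4 * ((s - m * (2 / 3)) ^ 2 / N) := by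
  have h3 : √3 ^ 2 = 3 := Real.sq_sqrt (by norm_num)
  have h6 : √(6 * N) = √3 * √(2 * N) := by
    rw [← Real.sqrt_mul (by norm_num)]
    congr 1
    ring
  have h2 : √(2 * N) ^ 2 = 2 * N := Real.sq_sqrt (by positivity)
  have p3 : 0 < √3 := by positivity
  have p2 : 0 < √(2 * N) := by positivity
  rw [h6, hm]
  generalize √(2 * N) = Y at *
  generalize √3 = T at *
  have hx : ((s - 2 / 9 * N) / (T * Y / 9)) ^ 2 = 27 * (s - 2 / 9 * N) ^ 2 / (2 * N) := by
    rw [div_pow, div_pow, mul_pow, h3, h2]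
    field_simp
    ring
  have hy : ((k - 2 / 3 * N) / (Y / 3)) ^ 2 = 9 * (k - 2 / 3 * N) ^ 2 / (2 * N) := by
    rw [div_pow, div_pow, h2]
    field_simp
    ring
  have hxy : 2 * T / 3 * ((s - 2 / 9 * N) / (T * Y / 9)) * ((k - 2 / 3 * N) / (Y / 3))
      = 18 * (s - 2 / 9 * N) * (k - 2 / 3 * N) / (2 * N) := by
    rw [← h2]
    field_simp
    ring
  rw [hx, hy, hxy]
  field_simp
  ring

lemma gaussian_normalization_eq {N k m : ℝ} (hN : 0 < N) (hk : 0 < k) (hm : 0 < m) :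
    2 * Real.pi * (√(6 * N) / 9) * (√(2 * N) / 3) * √(2 / 3)
      = √(2 / 9 * (k / N)⁻¹ * (m / N)⁻¹)
        * √(2 * Real.pi * k * (1 / 3) * (1 - 1 / 3))
        * √(2 * Real.pi * m * (2 / 3) * (1 - 2 / 3)) := by
  have hpi := Real.pi_pos
  have e : 2 * Real.pi * (√(6 * N) / 9) * (√(2 * N) / 3) * √(2 / 3)
      = 2 * Real.pi / 27 * (√(6 * N) * √(2 * N) * √(2 / 3)) := by ring
  have e2 : 2 * Real.pi / 27 = √((2 * Real.pi / 27) ^ 2) := (Real.sqrt_sq (by positivity)).symm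
  rw [e, e2, ← Real.sqrt_mul (by positivity), ← Real.sqrt_mul (by positivity),
    ← Real.sqrt_mul (by positivity), ← Real.sqrt_mul (by positivity),
    ← Real.sqrt_mul (by positivity)]
  congr 1
  field_simp
  ring

/-- The bivariate local central limit theorem for `jointProb`, along a filter. -/
theorem tendsto_jointProb_mul_gaussian {ι : Type*} {L : Filter ι} {N s k : ι → ℕ}
    (hN : Tendsto N L atTop)
    (hs : (fun i => (s i : ℝ) - 2 / 9 * N i) =O[L] fun i => √(N i : ℝ))
    (hk : (fun i => (k i : ℝ) - 2 / 3 * N i) =O[L] fun i => √(N i : ℝ)) :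
    Tendsto (fun i => jointProb (N i) (s i) (k i) * (2 * Real.pi) * (√(6 * (N i : ℝ)) / 9)
        * (√(2 * (N i : ℝ)) / 3) * √(2 / 3)
        * Real.exp (3 / 4 * ((((s i : ℝ) - 2 / 9 * N i) / (√(6 * (N i : ℝ)) / 9)) ^ 2
          + 2 * √3 / 3 * (((s i : ℝ) - 2 / 9 * N i) / (√(6 * (N i : ℝ)) / 9))
            * (((k i : ℝ) - 2 / 3 * N i) / (√(2 * (N i : ℝ)) / 3))
          + (((k i : ℝ) - 2 / 3 * N i) / (√(2 * (N i : ℝ)) / 3)) ^ 2))) L (𝓝 1) := by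
  have hNR : Tendsto (fun i => (N i : ℝ)) L atTop := tendsto_natCast_atTop_atTop.comp hN
  have hN0 := hNR.eventually_gt_atTop 0
  have hsN := tendsto_div_of_sub_mul_isBigO_sqrt hNR hs
  have hkN := tendsto_div_of_sub_mul_isBigO_sqrt hNR hk
  have hklt : ∀ᶠ i in L, k i < N i := by
    filter_upwards [hkN.eventually_lt_const (show (2 / 3 : ℝ) < 1 by norm_num), hN0] with i hi h0
    rw [div_lt_one h0] at hi
    exact_mod_cast hi
  have hm : (fun i => ((N i - k i : ℕ) : ℝ) - 1 / 3 * N i) =O[L] fun i => √(N i : ℝ) := by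
    refine hk.neg_left.congr' ?_ EventuallyEq.rfl
    filter_upwards [hklt] with i hi
    rw [Nat.cast_sub hi.le]
    ring
  have hmN := tendsto_div_of_sub_mul_isBigO_sqrt hNR hm
  have hs0 : ∀ᶠ i in L, 0 < s i := by
    filter_upwards [hsN.eventually_const_lt (show (0 : ℝ) < 2 / 9 by norm_num), hN0] with i hi h0
    rw [lt_div_iff₀ h0, zero_mul] at hi
    exact_mod_cast hi
  have hsk : ∀ᶠ i in L, s i < k i := by
    filter_upwards [hsN.eventually_lt hkN (by norm_num), hN0] with i hi h0
    rw [div_lt_div_iff_of_pos_right h0] at hi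
    exact_mod_cast hi
  have hsm : ∀ᶠ i in L, s i < N i - k i := by
    filter_upwards [hsN.eventually_lt hmN (by norm_num), hN0] with i hi h0
    rw [div_lt_div_iff_of_pos_right h0] at hi
    exact_mod_cast hi
  have hkT : Tendsto k L atTop := by
    refine tendsto_natCast_atTop_iff.1 ((hkN.pos_mul_atTop (by norm_num) hNR).congr' ?_)
    filter_upwards [hN0] with i hi
    field_simp
  have hmT : Tendsto (fun i => N i - k i) L atTop := by
    refine tendsto_natCast_atTop_iff.1 ((hmN.pos_mul_atTop (by norm_num) hNR).congr' ?_)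
    filter_upwards [hN0] with i hi
    field_simp
  have ha : (fun i => (s i : ℝ) - k i * (1 / 3)) =O[L] fun i => √(N i : ℝ) :=
    (hs.sub (hk.const_mul_left (1 / 3))).congr_left fun i => by ring
  have hb : (fun i => (s i : ℝ) - (N i - k i : ℕ) * (2 / 3)) =O[L] fun i => √(N i : ℝ) :=
    (hs.sub (hm.const_mul_left (2 / 3))).congr_left fun i => by ring
  have hB1 := tendsto_binomial_mul_gaussian (p := 1 / 3) (by norm_num) (by norm_num) hkT
    (ha.trans (isBigO_sqrt_of_tendsto_div (by norm_num) hNR hkN))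
  have hB2 := tendsto_binomial_mul_gaussian (p := 2 / 3) (by norm_num) (by norm_num) hmT
    (hb.trans (isBigO_sqrt_of_tendsto_div (by norm_num) hNR hmN))
  have hkI := hkN.inv₀ (by norm_num)
  have hmI := hmN.inv₀ (by norm_num)
  have hE1 := tendsto_sq_div_mul_zero hNR ha
    (g := fun i => 27 / 8 - 9 / 4 * ((k i : ℝ) / N i)⁻¹)
    ((hkI.const_mul (9 / 4)).const_sub (27 / 8) |>.trans_eq (by norm_num))
  have hE2 := tendsto_sq_div_mul_zero hNR hb
    (g := fun i => 27 / 4 - 9 / 4 * (((N i - k i : ℕ) : ℝ) / N i)⁻¹)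
    ((hmI.const_mul (9 / 4)).const_sub (27 / 4) |>.trans_eq (by norm_num))
  have hE := (Real.continuous_exp.tendsto _).comp (hE1.add hE2)
  have hR := ((hkI.const_mul (2 / 9)).mul hmI).sqrt
  have hP := (hsN.div hmN (by norm_num)).const_mul (3 / 2)
  have h := (((hP.mul hR).mul hB1).mul hB2).mul hE
  have hlim : (3 / 2 * (2 / 9 / (1 / 3)) * √(2 / 9 * (2 / 3)⁻¹ * (1 / 3)⁻¹) * 1 * 1
      * Real.exp (0 + 0) : ℝ) = 1 := by norm_num
  rw [hlim] at h
  refine h.congr' ?_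
  filter_upwards [hN0, hklt, hs0, hsk, hsm] with i h0 h1 h2 h3 h4
  have hk0 : (0 : ℝ) < k i := by exact_mod_cast h2.trans h3
  have hm0 : (0 : ℝ) < (N i - k i : ℕ) := by exact_mod_cast h2.trans h4
  have hnorm := gaussian_normalization_eq h0 hk0 hm0
  rw [jointProb_eq_mul_binomial h2 h3 h4 (Nat.add_sub_of_le h1.le).symm,
    gaussian_exponent_eq h0 (Nat.cast_sub h1.le)]
  have hexp : Real.exp (27 / 8 * (((s i : ℝ) - k i * (1 / 3)) ^ 2 / N i)
        + 27 / 4 * (((s i : ℝ) - (N i - k i : ℕ) * (2 / 3)) ^ 2 / N i))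
      = Real.exp (((s i : ℝ) - k i * (1 / 3)) ^ 2 / (2 * k i * (1 / 3) * (1 - 1 / 3)))
        * Real.exp (((s i : ℝ) - (N i - k i : ℕ) * (2 / 3)) ^ 2
          / (2 * (N i - k i : ℕ) * (2 / 3) * (1 - 2 / 3)))
        * Real.exp (((s i : ℝ) - k i * (1 / 3)) ^ 2 / N i
            * (27 / 8 - 9 / 4 * ((k i : ℝ) / N i)⁻¹)
          + ((s i : ℝ) - (N i - k i : ℕ) * (2 / 3)) ^ 2 / N i
            * (27 / 4 - 9 / 4 * (((N i - k i : ℕ) : ℝ) / N i)⁻¹)) := by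
    rw [← Real.exp_add, ← Real.exp_add]
    congr 1
    field_simp
    ring
  have hdiv : (s i : ℝ) / (N i - k i : ℕ) = s i / N i / ((N i - k i : ℕ) / N i) := by
    field_simp
  rw [hexp, hdiv]
  simp only [Function.comp_apply, Pi.div_apply]
  linear_combination (-(3 / 2 * ((s i : ℝ) / N i / ((N i - k i : ℕ) / N i))
      * (((k i).choose (s i) : ℝ) * (1 / 3) ^ s i * (1 - 1 / 3) ^ (k i - s i))
      * (((N i - k i).choose (s i) : ℝ) * (2 / 3) ^ s i * (1 - 2 / 3) ^ (N i - k i - s i))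
      * (Real.exp (((s i : ℝ) - k i * (1 / 3)) ^ 2 / (2 * k i * (1 / 3) * (1 - 1 / 3)))
        * Real.exp (((s i : ℝ) - (N i - k i : ℕ) * (2 / 3)) ^ 2
          / (2 * (N i - k i : ℕ) * (2 / 3) * (1 - 2 / 3)))
        * Real.exp (((s i : ℝ) - k i * (1 / 3)) ^ 2 / N i
            * (27 / 8 - 9 / 4 * ((k i : ℝ) / N i)⁻¹)
          + ((s i : ℝ) - (N i - k i : ℕ) * (2 / 3)) ^ 2 / N i
            * (27 / 4 - 9 / 4 * (((N i - k i : ℕ) : ℝ) / N i)⁻¹))))) * hnorm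

lemma abs_sub_le_of_div_mem_Ioo {d c M v C : ℝ} (hM : 0 < M) (hc : 0 < c) (hv : 0 < v)
    (h : d / (√(c * M) / v) ∈ Set.Ioo (-C) C) : |d| ≤ C * √c / v * |√M| := by
  have hcM : 0 < √(c * M) / v := by positivity
  rw [Set.mem_Ioo, ← abs_lt, abs_div, abs_of_pos hcM, div_lt_iff₀ hcM,
    Real.sqrt_mul hc.le] at h
  rw [abs_of_nonneg (Real.sqrt_nonneg M)]
  refine h.le.trans_eq ?_
  ring

/-- bivariate local central limit theorem for the joint
distribution of the number of dimers and the total number of dimers and single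
points, with limiting bivariate Gaussian of correlation `ρ = -1/√3`. -/
theorem bivariate_clt :
    ∀ C > (0 : ℝ), ∀ A > (0 : ℝ), ∀ ε > (0 : ℝ), ∃ N₀ : ℕ, ∀ N : ℕ, N₀ ≤ N →
      ∀ s k : ℕ,
        ((s : ℝ) - 2 / 9 * (N : ℝ)) / (Real.sqrt (6 * (N : ℝ)) / 9) ∈ Set.Ioo (-C) C →
        ((k : ℝ) - 2 / 3 * (N : ℝ)) / (Real.sqrt (2 * (N : ℝ)) / 3) ∈ Set.Ioo (-A) A →
        |jointProb N s k * (2 * Real.pi) * (Real.sqrt (6 * (N : ℝ)) / 9)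
            * (Real.sqrt (2 * (N : ℝ)) / 3) * Real.sqrt (2 / 3)
            * Real.exp (3 / 4 *
                ((((s : ℝ) - 2 / 9 * (N : ℝ)) / (Real.sqrt (6 * (N : ℝ)) / 9)) ^ 2
                  + 2 * Real.sqrt 3 / 3
                      * (((s : ℝ) - 2 / 9 * (N : ℝ)) / (Real.sqrt (6 * (N : ℝ)) / 9))
                      * (((k : ℝ) - 2 / 3 * (N : ℝ)) / (Real.sqrt (2 * (N : ℝ)) / 3))
                  + (((k : ℝ) - 2 / 3 * (N : ℝ)) / (Real.sqrt (2 * (N : ℝ)) / 3)) ^ 2))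
          - 1| < ε := by
  intro C hC A hA ε hε
  let S : Set (ℕ × ℕ × ℕ) := {q | 0 < q.1
    ∧ ((q.2.1 : ℝ) - 2 / 9 * q.1) / (√(6 * (q.1 : ℝ)) / 9) ∈ Set.Ioo (-C) C
    ∧ ((q.2.2 : ℝ) - 2 / 3 * q.1) / (√(2 * (q.1 : ℝ)) / 3) ∈ Set.Ioo (-A) A}
  let L : Filter (ℕ × ℕ × ℕ) := comap Prod.fst atTop ⊓ 𝓟 S
  have hS : ∀ᶠ q in L, q ∈ S := mem_inf_of_right (mem_principal_self S)
  have hN : Tendsto (fun q : ℕ × ℕ × ℕ => q.1) L atTop := tendsto_comap.mono_left inf_le_left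
  have hs : (fun q : ℕ × ℕ × ℕ => (q.2.1 : ℝ) - 2 / 9 * q.1) =O[L] fun q => √(q.1 : ℝ) := by
    refine IsBigO.of_bound (C * √6 / 9) ?_
    filter_upwards [hS] with q hq
    exact abs_sub_le_of_div_mem_Ioo (by exact_mod_cast hq.1) (by norm_num) (by norm_num) hq.2.1
  have hk : (fun q : ℕ × ℕ × ℕ => (q.2.2 : ℝ) - 2 / 3 * q.1) =O[L] fun q => √(q.1 : ℝ) := by
    refine IsBigO.of_bound (A * √2 / 3) ?_
    filter_upwards [hS] with q hq
    exact abs_sub_le_of_div_mem_Ioo (by exact_mod_cast hq.1) (by norm_num) (by norm_num) hq.2.2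
  have h := Metric.tendsto_nhds.1 (tendsto_jointProb_mul_gaussian hN hs hk) ε hε
  rw [eventually_inf_principal, eventually_comap] at h
  obtain ⟨N₀, hN₀⟩ := eventually_atTop.1 h
  refine ⟨N₀ + 1, fun N hle s k hx hy => ?_⟩
  exact hN₀ N (by omega) (N, s, k) rfl ⟨by omega, hx, hy⟩
end

section
/- A local central limit theorem holds for the number of dimers: for all C > 0 and ε > 0 there exists N₀ such that for all integers N ≥ N₀ and all integers s for which x := (s - (2/9)N)/(√(6N)/9) ∈ (-C, C), one has | S_N(s) · √(2π·(2/27)·N) · exp( (s - (2/9)N)² / ((4/27)N) ) - 1 | < ε, where S_N(s) := Σ_{k=s}^{N-s} C(k, s) · C(N-k-1, s-1) · (2/3)^{k-1} · (1/3)^{N-k}. -/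
/-- `S_N(s)`: the probability that the number of dimers equals `s`. -/
noncomputable def dimerNumberProb (N s : ℕ) : ℝ :=
  ∑ k ∈ Finset.Icc s (N - s),
    (k.choose s : ℝ) * ((N - k - 1).choose (s - 1) : ℝ)
      * (2 / 3 : ℝ) ^ (k - 1) * (1 / 3 : ℝ) ^ (N - k)

open Complex MeasureTheory Filter Topology

theorem integral_cexp_int_mul (k : ℤ) :
    ∫ t in (-Real.pi)..Real.pi, cexp (k * I * t) = if k = 0 then 2 * (Real.pi : ℂ) else 0 := by
  split_ifs with h
  · subst h
    simp
    ring
  · have hk : (k : ℂ) * I ≠ 0 := by simp [h]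
    rw [integral_exp_mul_complex hk]
    have : cexp (k * I * (Real.pi : ℝ)) = cexp (k * I * ((-Real.pi : ℝ) : ℂ)) := by
      rw [Complex.exp_eq_exp_iff_exists_int]
      exact ⟨k, by push_cast; ring⟩
    rw [this]
    simp

theorem integral_tsum_mul_cexp (c : ℕ → ℂ) (hc : Summable fun m => ‖c m‖) (n : ℕ) :
    ∫ t in (-Real.pi)..Real.pi, (∑' m, c m * cexp (t * I) ^ m) * cexp (-(n * I * t))
      = 2 * Real.pi * c n := by
  have key (m : ℕ) (t : ℝ) : c m * cexp (t * I) ^ m * cexp (-(n * I * t))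
      = c m * cexp (((m - n : ℤ) : ℂ) * I * t) := by
    rw [mul_assoc, ← Complex.exp_nat_mul, ← Complex.exp_add]
    congr 2
    push_cast
    ring
  have hnorm (m : ℕ) (t : ℝ) : ‖c m * cexp (((m - n : ℤ) : ℂ) * I * t)‖ = ‖c m‖ := by
    rw [norm_mul, show (((m - n : ℤ) : ℂ) * I * t) = (((m - n : ℤ) * t : ℝ) : ℂ) * I by
      push_cast; ring, Complex.norm_exp_ofReal_mul_I, mul_one]
  have hs := intervalIntegral.hasSum_integral_of_dominated_convergence (μ := volume)
    (a := -Real.pi) (b := Real.pi)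
    (F := fun m (t : ℝ) => c m * cexp (((m - n : ℤ) : ℂ) * I * t))
    (f := fun t : ℝ => (∑' m, c m * cexp (t * I) ^ m) * cexp (-(n * I * t)))
    (fun m _ => ‖c m‖)
    (fun m => (Continuous.aestronglyMeasurable (by fun_prop)))
    (fun m => ae_of_all _ fun t _ => (hnorm m t).le)
    (ae_of_all _ fun t _ => hc)
    (by simp)
    (ae_of_all _ fun t _ => by
      simp_rw [← key]
      refine HasSum.mul_right _ (Summable.hasSum (Summable.of_norm ?_))
      simpa [Complex.norm_exp_ofReal_mul_I] using hc)
  rw [← hs.tsum_eq, tsum_eq_single n]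
  · rw [intervalIntegral.integral_const_mul, integral_cexp_int_mul]
    simp
    ring
  · intro m hm
    rw [intervalIntegral.integral_const_mul, integral_cexp_int_mul, if_neg (by omega), mul_zero]

/-- Coefficients of the power series of `(1 - 2z/3)⁻ʳ⁻² (1 - z/3)⁻ʳ⁻¹`. -/
noncomputable def dimerCoeff (r n : ℕ) : ℂ :=
  ∑ p ∈ Finset.HasAntidiagonal.antidiagonal n,
    (((p.1 + (r + 1)).choose (r + 1) : ℂ) * (2 / 3) ^ p.1) * (((p.2 + r).choose r : ℂ) * (1 / 3) ^ p.2)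

theorem dimerNumberProb_eq_dimerCoeff (r n : ℕ) :
    (dimerNumberProb (n + 2 * (r + 1)) (r + 1) : ℂ)
      = (2 / 3) ^ r * (1 / 3) ^ (r + 1) * dimerCoeff r n := by
  rw [dimerNumberProb, dimerCoeff, Finset.Nat.sum_antidiagonal_eq_sum_range_succ
    (fun i j => (((i + (r + 1)).choose (r + 1) : ℂ) * (2 / 3) ^ i) *
    (((j + r).choose r : ℂ) * (1 / 3) ^ j)),
    show Finset.Icc (r + 1) (n + 2 * (r + 1) - (r + 1)) =
      Finset.Ico (0 + (r + 1)) (n.succ + (r + 1)) by ext; simp; omega,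
    ← Finset.sum_Ico_add', Finset.range_eq_Ico, Finset.mul_sum]
  push_cast
  refine Finset.sum_congr rfl fun k hk => ?_
  have hk : k ≤ n := by simp at hk; omega
  obtain ⟨j, rfl⟩ := Nat.exists_eq_add_of_le hk
  rw [show k + j + 2 * (r + 1) - (k + (r + 1)) - 1 = j + r by omega,
    show k + (r + 1) - 1 = k + r by omega,
    show k + j + 2 * (r + 1) - (k + (r + 1)) = j + (r + 1) by omega,
    show k + j - k = j by omega]
  ring

theorem dimerCoeff_mul_pow (r n : ℕ) (z : ℂ) : dimerCoeff r n * z ^ n =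
    ∑ p ∈ Finset.HasAntidiagonal.antidiagonal n,
      (((p.1 + (r + 1)).choose (r + 1) : ℂ) * (2 / 3 * z) ^ p.1) *
        (((p.2 + r).choose r : ℂ) * (1 / 3 * z) ^ p.2) := by
  rw [dimerCoeff, Finset.sum_mul]
  refine Finset.sum_congr rfl fun p hp => ?_
  rw [← Finset.HasAntidiagonal.mem_antidiagonal.1 hp, mul_pow, mul_pow, pow_add]
  ac_rfl

theorem HasSum.summable_and_tsum_antidiagonal {f g : ℕ → ℂ} {a b : ℂ}
    (hf : HasSum f a) (hg : HasSum g b) :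
    (Summable fun n => ‖∑ p ∈ Finset.HasAntidiagonal.antidiagonal n, f p.1 * g p.2‖) ∧
    ∑' n, ∑ p ∈ Finset.HasAntidiagonal.antidiagonal n, f p.1 * g p.2 = a * b := by
  refine ⟨summable_norm_sum_mul_antidiagonal_of_summable_norm hf.summable.norm hg.summable.norm, ?_⟩
  rw [← hf.tsum_eq, ← hg.tsum_eq]
  exact (tsum_mul_tsum_eq_tsum_sum_antidiagonal_of_summable_norm hf.summable.norm
    hg.summable.norm).symm

theorem summable_and_tsum_dimerCoeff (r : ℕ) (z : ℂ) (hz : ‖z‖ = 1) :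
    (Summable fun n => ‖dimerCoeff r n * z ^ n‖) ∧
    ∑' n, dimerCoeff r n * z ^ n =
      1 / (1 - 2 / 3 * z) ^ (r + 1 + 1) * (1 / (1 - 1 / 3 * z) ^ (r + 1)) := by
  have ha : ‖2 / 3 * z‖ < 1 := by rw [norm_mul, hz]; norm_num
  have hb : ‖1 / 3 * z‖ < 1 := by rw [norm_mul, hz]; norm_num
  have := HasSum.summable_and_tsum_antidiagonal
    (hasSum_choose_mul_geometric_of_norm_lt_one (r + 1) ha)
    (hasSum_choose_mul_geometric_of_norm_lt_one r hb)
  simp only [dimerCoeff_mul_pow]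
  exact this

/-- Reciprocal of the centred characteristic function of the gap between consecutive dimers. -/
noncomputable def gapCharInv (t : ℝ) : ℂ :=
  9 / 2 * cexp (5 / 2 * t * I) - 9 / 2 * cexp (7 / 2 * t * I) + cexp (9 / 2 * t * I)

theorem gapCharInv_eq (t : ℝ) : gapCharInv t =
    9 / 2 * cexp (5 / 2 * t * I) * ((1 - 2 / 3 * cexp (t * I)) * (1 - 1 / 3 * cexp (t * I))) := by
  rw [gapCharInv, show (7 / 2 * t * I : ℂ) = 5 / 2 * t * I + t * I by ring,
    show (9 / 2 * t * I : ℂ) = 5 / 2 * t * I + t * I + t * I by ring]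
  simp only [Complex.exp_add]
  ring

/-- Generating function of the final segment, on the unit circle. -/
noncomputable def endWeight (t : ℝ) : ℂ := 3 / 2 * (1 - 2 / 3 * cexp (t * I))⁻¹

theorem one_sub_mul_cexp_ne_zero (a t : ℝ) (ha : |a| < 1) : 1 - a * cexp (t * I) ≠ 0 := by
  intro h
  have h2 : ‖a * cexp (t * I)‖ = 1 := by rw [← sub_eq_zero.1 h, norm_one]
  rw [norm_mul, Complex.norm_exp_ofReal_mul_I, mul_one, Complex.norm_real, Real.norm_eq_abs] at h2
  exact ha.ne h2

theorem one_sub_two_thirds_ne_zero (t : ℝ) : 1 - 2 / 3 * cexp (t * I) ≠ 0 := by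
  simpa using one_sub_mul_cexp_ne_zero (2 / 3) t (by rw [abs_of_pos] <;> norm_num)

theorem one_sub_one_third_ne_zero (t : ℝ) : 1 - 1 / 3 * cexp (t * I) ≠ 0 := by
  simpa using one_sub_mul_cexp_ne_zero (1 / 3) t (by rw [abs_of_pos] <;> norm_num)

theorem gapCharInv_ne_zero (t : ℝ) : gapCharInv t ≠ 0 := by
  rw [gapCharInv_eq]
  exact mul_ne_zero (mul_ne_zero (by norm_num) (Complex.exp_ne_zero _))
    (mul_ne_zero (one_sub_two_thirds_ne_zero t) (one_sub_one_third_ne_zero t))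

theorem continuous_gapCharInv : Continuous gapCharInv := by
  unfold gapCharInv
  fun_prop

theorem continuous_endWeight : Continuous endWeight := by
  unfold endWeight
  exact continuous_const.mul (Continuous.inv₀ (by fun_prop) one_sub_two_thirds_ne_zero)

theorem integral_eq_dimerNumberProb (N s : ℕ) (hs : 1 ≤ s) (hN : 2 * s ≤ N) :
    ∫ t in (-Real.pi)..Real.pi, (gapCharInv t)⁻¹ ^ s * endWeight t
      * cexp (-((N - 9 / 2 * s : ℝ) * t * I)) = 2 * Real.pi * dimerNumberProb N s := by
  obtain ⟨r, rfl⟩ := Nat.exists_eq_add_of_le' hs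
  obtain ⟨n, rfl⟩ := Nat.exists_eq_add_of_le' hN
  rw [dimerNumberProb_eq_dimerCoeff, mul_left_comm, ← integral_tsum_mul_cexp _
    (by simpa using (summable_and_tsum_dimerCoeff r 1 (by simp)).1),
    ← intervalIntegral.integral_const_mul]
  refine intervalIntegral.integral_congr fun t _ => ?_
  rw [(summable_and_tsum_dimerCoeff r _ (Complex.norm_exp_ofReal_mul_I t)).2, gapCharInv_eq,
    endWeight,
    show (-(((n + 2 * (r + 1) : ℕ) - 9 / 2 * (r + 1 : ℕ) : ℝ) * t * I) : ℂ)
      = (r + 1 : ℕ) * (5 / 2 * t * I) + (-(n * I * t)) by push_cast; ring,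
    Complex.exp_add, Complex.exp_nat_mul]
  have h1 := one_sub_two_thirds_ne_zero t
  have h2 := one_sub_one_third_ne_zero t
  generalize 1 - 2 / 3 * cexp (t * I) = A at *
  generalize 1 - 1 / 3 * cexp (t * I) = B at *
  have h3 := Complex.exp_ne_zero (5 / 2 * t * I)
  generalize cexp (5 / 2 * t * I) = E at *
  have : (9 : ℂ) = 3 * 3 := by norm_num
  simp only [inv_pow, mul_pow, div_pow, this]
  field_simp
  ring

theorem norm_sq_one_sub (a t : ℝ) :
    ‖1 - a * cexp (t * I)‖ ^ 2 = (1 - a) ^ 2 + 2 * a * (1 - Real.cos t) := by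
  rw [Complex.sq_norm, Complex.normSq_apply]
  simp [Complex.exp_ofReal_mul_I_re, Complex.exp_ofReal_mul_I_im]
  linear_combination a ^ 2 * Real.sin_sq_add_cos_sq t

theorem le_norm_gapCharInv (t : ℝ) (ht : |t| ≤ Real.pi) : 1 + t ^ 2 / 2 ≤ ‖gapCharInv t‖ := by
  have h1 := norm_sq_one_sub (2 / 3) t
  have h2 := norm_sq_one_sub (1 / 3) t
  have h3 := Real.cos_le_one_sub_mul_cos_sq ht
  have h4 : t ^ 2 / 2 ≤ 3 * (1 - Real.cos t) := by
    have : 1 / 6 * t ^ 2 ≤ 2 / Real.pi ^ 2 * t ^ 2 := by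
      gcongr ?_ * _
      rw [div_le_div_iff₀ (by norm_num) (by positivity)]
      nlinarith [Real.pi_lt_d2, Real.pi_pos]
    linarith
  refine le_of_sq_le_sq ?_ (norm_nonneg _) |>.trans' (by linarith : _ ≤ 1 + 3 * (1 - Real.cos t))
  have h5 : ‖gapCharInv t‖ = 9 / 2 * (‖1 - (2 / 3 : ℝ) * cexp (t * I)‖
      * ‖1 - (1 / 3 : ℝ) * cexp (t * I)‖) := by
    rw [gapCharInv_eq, norm_mul, norm_mul, norm_mul,
      show (5 / 2 * t * I : ℂ) = (5 / 2 * t : ℝ) * I by push_cast; ring,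
      Complex.norm_exp_ofReal_mul_I]
    simp
  rw [h5, mul_pow, mul_pow, h1, h2]
  nlinarith [sq_nonneg t]

theorem norm_endWeight_le (t : ℝ) : ‖endWeight t‖ ≤ 9 / 2 := by
  have h : 1 / 3 ≤ ‖1 - 2 / 3 * cexp (t * I)‖ := by
    have := norm_sub_norm_le 1 (2 / 3 * cexp (t * I))
    rw [norm_mul, Complex.norm_exp_ofReal_mul_I] at this
    norm_num at this
    linarith
  rw [endWeight, norm_mul, norm_inv]
  have := inv_anti₀ (by norm_num) h
  norm_num at this ⊢
  linarith

theorem cexp_mul_I_taylor_two (c : ℂ) :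
    (fun u : ℝ => cexp (c * u * I) - (1 + c * u * I - c ^ 2 * u ^ 2 / 2)) =o[𝓝 0]
      (fun u : ℝ => (u : ℂ) ^ 2) := by
  have hlim : Tendsto (fun u : ℝ => c * u * I) (𝓝 0) (𝓝 0) := by
    have : Continuous (fun u : ℝ => c * u * I) := by fun_prop
    simpa using this.tendsto 0
  have h := ((exp_sub_sum_range_succ_isLittleO_pow 2).comp_tendsto hlim).congr_right
    (g₂ := fun u : ℝ => (c ^ 2 * I ^ 2) * (u : ℂ) ^ 2) (fun u => by
      simp only [Function.comp_apply]; ring)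
  refine (h.trans_isBigO (Asymptotics.isBigO_const_mul_self _ _ _)).congr_left fun u => ?_
  simp [Finset.sum_range_succ, mul_pow]
  ring

theorem gapCharInv_taylor_two :
    (fun u : ℝ => gapCharInv u - (1 + 27 / 8 * (u : ℂ) ^ 2)) =o[𝓝 0]
      (fun u : ℝ => (u : ℂ) ^ 2) := by
  refine ((((cexp_mul_I_taylor_two (5 / 2)).const_mul_left (9 / 2)).sub
    ((cexp_mul_I_taylor_two (7 / 2)).const_mul_left (9 / 2))).add
    (cexp_mul_I_taylor_two (9 / 2))).congr_left fun u => ?_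
  rw [gapCharInv]
  ring

theorem tendsto_div_sqrt_natCast (t : ℝ) : Tendsto (fun s : ℕ => t / √(s : ℝ)) atTop (𝓝 0) :=
  (Real.tendsto_sqrt_atTop.comp tendsto_natCast_atTop_atTop).const_div_atTop t

theorem tendsto_gapCharInv_pow (t : ℝ) :
    Tendsto (fun s : ℕ => gapCharInv (t / √(s : ℝ)) ^ s) atTop (𝓝 (cexp (27 / 8 * t ^ 2))) := by
  refine tendsto_pow_exp_of_isLittleO_sub_add_div _ ?_
  have hsq (s : ℕ) : ((t / √(s : ℝ) : ℝ) : ℂ) ^ 2 = t ^ 2 * (1 / s) := by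
    rw [← Complex.ofReal_pow, div_pow, Real.sq_sqrt (Nat.cast_nonneg s)]
    push_cast
    ring
  have h := (gapCharInv_taylor_two.comp_tendsto (tendsto_div_sqrt_natCast t)).congr_right
    (g₂ := fun s : ℕ => (t : ℂ) ^ 2 * (1 / (s : ℂ))) hsq
  refine (h.trans_isBigO (Asymptotics.isBigO_const_mul_self _ _ _)).congr_left fun s => ?_
  simp only [Function.comp_apply, hsq]
  ring

/-- Integrand of the inversion formula at scale `√s`, without the oscillating factor. -/
noncomputable def rescaledChar (s : ℕ) : ℝ → ℂ :=
  (Set.Ioc (-(Real.pi * √(s : ℝ))) (Real.pi * √(s : ℝ))).indicator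
    fun t => (gapCharInv (t / √(s : ℝ)))⁻¹ ^ s * endWeight (t / √(s : ℝ))

theorem measurable_rescaledChar (s : ℕ) : Measurable (rescaledChar s) := by
  refine Measurable.indicator (Continuous.measurable ?_) measurableSet_Ioc
  exact (((continuous_gapCharInv.inv₀ gapCharInv_ne_zero).comp (continuous_id.div_const _)).pow
    s).mul (continuous_endWeight.comp (continuous_id.div_const _))

theorem norm_rescaledChar_le (s : ℕ) (hs : 1 ≤ s) (t : ℝ) :
    ‖rescaledChar s t‖ ≤ 9 * (1 + t ^ 2)⁻¹ := by
  have hs' : (0 : ℝ) < s := by exact_mod_cast hs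
  rw [rescaledChar, norm_indicator_eq_indicator_norm]
  refine Set.indicator_apply_le' (fun ht => ?_) (fun _ => by positivity)
  have hle : |t / √(s : ℝ)| ≤ Real.pi := by
    rw [abs_div, abs_of_pos (Real.sqrt_pos.2 hs'), div_le_iff₀ (Real.sqrt_pos.2 hs')]
    exact abs_le.2 ⟨ht.1.le, ht.2⟩
  have hpow : (1 + t ^ 2) / 2 ≤ ‖gapCharInv (t / √(s : ℝ))‖ ^ s := by
    calc (1 + t ^ 2) / 2 ≤ 1 + s * ((t / √(s : ℝ)) ^ 2 / 2) := by
          rw [div_pow, Real.sq_sqrt hs'.le]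
          field_simp
          linarith
      _ ≤ (1 + (t / √(s : ℝ)) ^ 2 / 2) ^ s :=
          one_add_mul_le_pow (by linarith [sq_nonneg (t / √(s : ℝ))]) s
      _ ≤ _ := by gcongr; exact le_norm_gapCharInv _ hle
  rw [norm_mul, norm_pow, norm_inv, inv_pow]
  calc _ ≤ ((1 + t ^ 2) / 2)⁻¹ * (9 / 2) := by
        gcongr
        exact norm_endWeight_le _
    _ = _ := by field_simp

theorem integrable_rescaledChar (s : ℕ) (hs : 1 ≤ s) : Integrable (rescaledChar s) :=
  (integrable_inv_one_add_sq.const_mul 9).mono' (measurable_rescaledChar s).aestronglyMeasurable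
    (ae_of_all _ (norm_rescaledChar_le s hs))

theorem tendsto_rescaledChar (t : ℝ) :
    Tendsto (fun s => rescaledChar s t) atTop (𝓝 (9 / 2 * cexp (-(27 / 8) * t ^ 2))) := by
  have hw : Tendsto (fun s : ℕ => endWeight (t / √(s : ℝ))) atTop (𝓝 (9 / 2)) := by
    have : endWeight 0 = 9 / 2 := by simp [endWeight]; norm_num
    rw [← this]
    exact (continuous_endWeight.tendsto 0).comp (tendsto_div_sqrt_natCast t)
  have h := ((tendsto_gapCharInv_pow t).inv₀ (Complex.exp_ne_zero _)).mul hw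
  rw [← Complex.exp_neg, mul_comm, ← neg_mul] at h
  refine h.congr' ?_
  have hlarge : Tendsto (fun s : ℕ => Real.pi * √(s : ℝ)) atTop atTop :=
    (Real.tendsto_sqrt_atTop.comp tendsto_natCast_atTop_atTop).const_mul_atTop Real.pi_pos
  filter_upwards [hlarge.eventually_gt_atTop |t|] with s hs
  rw [rescaledChar, Set.indicator_of_mem, inv_pow]
  exact ⟨(abs_lt.1 hs).1, (abs_lt.1 hs).2.le⟩

theorem integrable_gaussian : Integrable fun t : ℝ => 9 / 2 * cexp (-(27 / 8) * (t : ℂ) ^ 2) :=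
  (integrable_cexp_neg_mul_sq (b := 27 / 8) (by norm_num)).const_mul _

/-- The `L¹` distance between the rescaled characteristic function and its Gaussian limit. -/
noncomputable def rescaledCharError (s : ℕ) : ℝ :=
  ∫ t : ℝ, ‖rescaledChar s t - 9 / 2 * cexp (-(27 / 8) * t ^ 2)‖

theorem tendsto_rescaledCharError : Tendsto rescaledCharError atTop (𝓝 0) := by
  have hlim (t : ℝ) : Tendsto (fun s => ‖rescaledChar s t - 9 / 2 * cexp (-(27 / 8) * t ^ 2)‖)
      atTop (𝓝 0) := by
    have := ((tendsto_rescaledChar t).sub_const (9 / 2 * cexp (-(27 / 8) * t ^ 2))).norm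
    rwa [sub_self, norm_zero] at this
  have h := tendsto_integral_filter_of_dominated_convergence (μ := volume) (l := atTop)
    (F := fun s (t : ℝ) => ‖rescaledChar s t - 9 / 2 * cexp (-(27 / 8) * t ^ 2)‖)
    (f := fun _ => (0 : ℝ))
    (fun t => 9 * (1 + t ^ 2)⁻¹ + ‖9 / 2 * cexp (-(27 / 8) * (t : ℂ) ^ 2)‖)
    (Eventually.of_forall fun s => ((measurable_rescaledChar s).aestronglyMeasurable.sub
      integrable_gaussian.1).norm)
    (by
      filter_upwards [eventually_ge_atTop 1] with s hs
      refine ae_of_all _ fun t => ?_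
      rw [norm_norm]
      exact (norm_sub_le _ _).trans (by gcongr; exact norm_rescaledChar_le s hs t))
    ((integrable_inv_one_add_sq.const_mul 9).add integrable_gaussian.norm)
    (ae_of_all _ hlim)
  rwa [integral_zero] at h

theorem integral_rescaledChar (N s : ℕ) (hs : 1 ≤ s) (hN : 2 * s ≤ N) :
    ∫ t : ℝ, cexp (I * (-((N - 9 / 2 * s) / √(s : ℝ)) : ℝ) * t) * rescaledChar s t
      = 2 * Real.pi * (√(s : ℝ) * dimerNumberProb N s : ℝ) := by
  have hs' : (0 : ℝ) < √(s : ℝ) := Real.sqrt_pos.2 (by exact_mod_cast hs)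
  have h := intervalIntegral.integral_comp_div (a := -(Real.pi * √(s : ℝ)))
    (b := Real.pi * √(s : ℝ)) (fun t => (gapCharInv t)⁻¹ ^ s * endWeight t
      * cexp (-((N - 9 / 2 * s : ℝ) * t * I))) hs'.ne'
  rw [neg_div, mul_div_cancel_right₀ _ hs'.ne', integral_eq_dimerNumberProb N s hs hN,
    intervalIntegral.integral_of_le (by linarith [mul_pos Real.pi_pos hs']),
    ← integral_indicator measurableSet_Ioc] at h
  trans √(s : ℝ) • (2 * Real.pi * dimerNumberProb N s : ℂ)
  · rw [← h]
    refine integral_congr_ae (ae_of_all _ fun t => ?_)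
    simp only [rescaledChar]
    rw [← Set.indicator_mul_right _ (fun t : ℝ =>
      cexp (I * (-((N - 9 / 2 * s) / √(s : ℝ)) : ℝ) * t))]
    refine congrFun (congrArg _ (funext fun t => ?_)) t
    rw [mul_comm]
    congr 2
    push_cast
    ring
  · rw [Complex.real_smul]
    push_cast
    ring

theorem integral_gaussian_mul_cexp (y : ℝ) :
    ∫ t : ℝ, cexp (I * (-y : ℝ) * t) * (9 / 2 * cexp (-(27 / 8) * t ^ 2))
      = (9 / 2 * √(Real.pi / (27 / 8)) * Real.exp (-(2 / 27 * y ^ 2)) : ℝ) := by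
  have h := fourierIntegral_gaussian (b := 27 / 8) (by norm_num) (-y : ℝ)
  simp_rw [mul_left_comm _ (9 / 2 : ℂ)]
  rw [integral_const_mul, h, Real.sqrt_eq_rpow]
  push_cast
  rw [Complex.ofReal_cpow (by positivity)]
  push_cast
  rw [show (-(-(y : ℂ)) ^ 2 / (4 * (27 / 8))) = -(2 / 27 * (y : ℂ) ^ 2) by ring]
  ring

/-- Local limit theorem in the length variable, uniform in the length. -/
theorem abs_sqrt_mul_dimerNumberProb_sub_le (N s : ℕ) (hs : 1 ≤ s) (hN : 2 * s ≤ N) :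
    |2 * Real.pi * (√(s : ℝ) * dimerNumberProb N s) - 9 / 2 * √(Real.pi / (27 / 8)) *
      Real.exp (-(2 / 27 * ((N - 9 / 2 * s) / √(s : ℝ)) ^ 2))| ≤ rescaledCharError s := by
  set y := (N - 9 / 2 * s) / √(s : ℝ) with hy
  have hnorm (t : ℝ) : ‖cexp (I * (-y : ℝ) * t)‖ = 1 := by
    rw [show I * (-y : ℝ) * t = ((-y * t : ℝ) : ℂ) * I by push_cast; ring,
      Complex.norm_exp_ofReal_mul_I]
  have hmul {f : ℝ → ℂ} (hf : Integrable f) :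
      Integrable fun t : ℝ => cexp (I * (-y : ℝ) * t) * f t :=
    hf.bdd_mul (c := 1) (Continuous.aestronglyMeasurable (by fun_prop))
      (ae_of_all _ fun t => (hnorm t).le)
  have h1 := integral_rescaledChar N s hs hN
  rw [← hy] at h1
  have h2 := integral_gaussian_mul_cexp y
  rw [← Real.norm_eq_abs, ← Complex.norm_real, Complex.ofReal_sub, ← h2,
    Complex.ofReal_mul (2 * Real.pi), Complex.ofReal_mul 2, Complex.ofReal_ofNat, ← h1,
    ← integral_sub (hmul (integrable_rescaledChar s hs)) (hmul integrable_gaussian)]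
  refine (norm_integral_le_integral_norm _).trans_eq ?_
  refine integral_congr_ae (ae_of_all _ fun t => ?_)
  simp only [← mul_sub, norm_mul, hnorm, one_mul]
/-- The regime of the local limit theorem: `N → ∞` with `s` within `C` standard deviations of the
mean number of dimers. -/
def centralRegime (C : ℝ) : Filter (ℕ × ℕ) :=
  comap Prod.fst atTop ⊓
    𝓟 {p | |(p.2 : ℝ) - 2 / 9 * (p.1 : ℝ)| ≤ C * (√(6 * (p.1 : ℝ)) / 9)}

theorem tendsto_fst_centralRegime (C : ℝ) :
    Tendsto (fun p : ℕ × ℕ => (p.1 : ℝ)) (centralRegime C) atTop :=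
  tendsto_natCast_atTop_atTop.comp (tendsto_comap.mono_left inf_le_left)

theorem eventually_centralRegime (C : ℝ) :
    ∀ᶠ p in centralRegime C, |(p.2 : ℝ) - 2 / 9 * (p.1 : ℝ)| ≤ C * (√(6 * (p.1 : ℝ)) / 9) :=
  mem_inf_of_right (mem_principal_self _)

theorem tendsto_div_centralRegime (C : ℝ) :
    Tendsto (fun p : ℕ × ℕ => (p.2 : ℝ) / p.1) (centralRegime C) (𝓝 (2 / 9)) := by
  rw [tendsto_iff_norm_sub_tendsto_zero]
  have hlim : Tendsto (fun p : ℕ × ℕ => C * √6 / 9 / √(p.1 : ℝ)) (centralRegime C) (𝓝 0) :=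
    (Real.tendsto_sqrt_atTop.comp (tendsto_fst_centralRegime C)).const_div_atTop _
  refine squeeze_zero' (Eventually.of_forall fun _ => norm_nonneg _) ?_ hlim
  filter_upwards [eventually_centralRegime C,
    (tendsto_fst_centralRegime C).eventually_gt_atTop 0] with p hp h0
  have h1 : (p.2 : ℝ) / p.1 - 2 / 9 = (p.2 - 2 / 9 * p.1) / p.1 := by field_simp
  rw [h1, Real.norm_eq_abs, abs_div, abs_of_pos h0, div_le_div_iff₀ h0 (Real.sqrt_pos.2 h0)]
  rw [Real.sqrt_mul (by norm_num)] at hp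
  calc _ ≤ C * (√6 * √(p.1 : ℝ) / 9) * √(p.1 : ℝ) := by gcongr
    _ = C * √6 / 9 * (√(p.1 : ℝ) * √(p.1 : ℝ)) := by ring
    _ = _ := by rw [Real.mul_self_sqrt h0.le]

theorem tendsto_snd_centralRegime (C : ℝ) : Tendsto Prod.snd (centralRegime C) atTop := by
  rw [← tendsto_natCast_atTop_iff (R := ℝ)]
  refine ((tendsto_fst_centralRegime C).atTop_mul_pos (by norm_num)
    (tendsto_div_centralRegime C)).congr' ?_
  filter_upwards [(tendsto_fst_centralRegime C).eventually_gt_atTop 0] with p h0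
  field_simp

theorem sq_div_le_of_abs_le {C n u : ℝ} (hn : 0 < n) (hu : |u| ≤ C * (√(6 * n) / 9)) :
    u ^ 2 / (4 / 27 * n) ≤ C ^ 2 / 2 := by
  rw [div_le_iff₀ (by positivity)]
  calc u ^ 2 = |u| ^ 2 := (sq_abs u).symm
    _ ≤ (C * (√(6 * n) / 9)) ^ 2 := by gcongr
    _ = C ^ 2 / 2 * (4 / 27 * n) := by
      rw [mul_pow, div_pow, Real.sq_sqrt (by positivity)]
      ring

theorem tendsto_dimerNumberProb_mul (C : ℝ) :
    Tendsto (fun p : ℕ × ℕ => dimerNumberProb p.1 p.2 * √(2 * Real.pi * (2 / 27) * (p.1 : ℝ))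
      * Real.exp (((p.2 : ℝ) - 2 / 9 * (p.1 : ℝ)) ^ 2 / (4 / 27 * (p.1 : ℝ))))
      (centralRegime C) (𝓝 1) := by
  set q : ℕ × ℕ → ℝ := fun p => ((p.2 : ℝ) - 2 / 9 * (p.1 : ℝ)) ^ 2 / (4 / 27 * (p.1 : ℝ)) with hq
  set ρ : ℕ × ℕ → ℝ := fun p => 2 / 9 * ((p.2 : ℝ) / p.1)⁻¹ with hρ
  set κ : ℝ := √(2 * Real.pi * (2 / 27)) * √(9 / 2) / (2 * Real.pi) with hκ
  set R : ℕ × ℕ → ℝ := fun p => 2 * Real.pi * (√(p.2 : ℝ) * dimerNumberProb p.1 p.2) with hR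
  set G : ℕ × ℕ → ℝ := fun p => 9 / 2 * √(Real.pi / (27 / 8)) *
    Real.exp (-(2 / 27 * (((p.1 : ℝ) - 9 / 2 * p.2) / √(p.2 : ℝ)) ^ 2)) with hG
  have hN := (tendsto_fst_centralRegime C).eventually_gt_atTop 0
  have hs := (tendsto_snd_centralRegime C).eventually_ge_atTop 1
  have h2s : ∀ᶠ p in centralRegime C, 2 * p.2 ≤ p.1 := by
    filter_upwards [(tendsto_div_centralRegime C).eventually_le_const
      (show (2 / 9 : ℝ) < 1 / 2 by norm_num), hN] with p hp h0
    rw [div_le_iff₀ h0] at hp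
    have : 2 * (p.2 : ℝ) ≤ p.1 := by linarith
    exact_mod_cast this
  have hρlim : Tendsto ρ (centralRegime C) (𝓝 1) := by
    have := ((tendsto_div_centralRegime C).inv₀ (by norm_num)).const_mul (2 / 9)
    rwa [mul_inv_cancel₀ (by norm_num)] at this
  have hqle : ∀ᶠ p in centralRegime C, |q p| ≤ C ^ 2 / 2 := by
    filter_upwards [eventually_centralRegime C, hN] with p hp h0
    rw [abs_of_nonneg (by positivity)]
    exact sq_div_le_of_abs_le h0 hp
  have hRG : Tendsto (fun p => R p - G p) (centralRegime C) (𝓝 0) := by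
    refine squeeze_zero_norm' ?_
      (tendsto_rescaledCharError.comp (tendsto_snd_centralRegime C))
    filter_upwards [hs, h2s] with p h1 h2
    exact abs_sqrt_mul_dimerNumberProb_sub_le p.1 p.2 h1 h2
  have hqρ : Tendsto (fun p => q p * (1 - ρ p)) (centralRegime C) (𝓝 0) := by
    have h1 : Tendsto (fun p => 1 - ρ p) (centralRegime C) (𝓝 0) := by
      simpa using hρlim.const_sub 1
    exact isBoundedUnder_le_mul_tendsto_zero (isBoundedUnder_of_eventually_le hqle) h1
  have herr : Tendsto (fun p => κ * √(ρ p) * (Real.exp (q p) * (R p - G p)))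
      (centralRegime C) (𝓝 0) := by
    have hb : ∀ᶠ p in centralRegime C, ‖Real.exp (q p)‖ ≤ Real.exp (C ^ 2 / 2) := by
      filter_upwards [hqle] with p hp
      rw [Real.norm_eq_abs, Real.abs_exp]
      exact Real.exp_le_exp.2 ((le_abs_self _).trans hp)
    have := (hρlim.sqrt.const_mul κ).mul
      (isBoundedUnder_le_mul_tendsto_zero (isBoundedUnder_of_eventually_le hb) hRG)
    rwa [mul_zero] at this
  have hmain : Tendsto (fun p => √(ρ p) * Real.exp (q p * (1 - ρ p)))
      (centralRegime C) (𝓝 1) := by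
    have := hρlim.sqrt.mul ((Real.continuous_exp.tendsto 0).comp hqρ)
    simpa using this
  have := herr.add hmain
  rw [zero_add] at this
  refine this.congr' ?_
  have hκG : κ * (9 / 2 * √(Real.pi / (27 / 8))) = 1 := by
    have hpi := Real.pi_pos
    have h1 : √(2 * Real.pi * (2 / 27)) * √(9 / 2) * √(Real.pi / (27 / 8))
        = 4 / 9 * Real.pi := by
      rw [← Real.sqrt_mul (by positivity), ← Real.sqrt_mul (by positivity),
        Real.sqrt_eq_iff_mul_self_eq (by positivity) (by positivity)]
      ring
    rw [hκ, div_mul_eq_mul_div, mul_left_comm, h1]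
    field_simp
    norm_num
  filter_upwards [hN, hs] with p h0 h1
  have hs0 : (0 : ℝ) < p.2 := by exact_mod_cast h1
  have hGp : κ * (Real.exp (q p) * G p) = Real.exp (q p * (1 - ρ p)) := by
    rw [show q p * (1 - ρ p)
      = q p + -(2 / 27 * (((p.1 : ℝ) - 9 / 2 * p.2) / √(p.2 : ℝ)) ^ 2) by
        simp only [hq, hρ]
        rw [div_pow, Real.sq_sqrt hs0.le]
        field_simp
        ring, Real.exp_add]
    linear_combination (Real.exp (q p) *
      Real.exp (-(2 / 27 * (((p.1 : ℝ) - 9 / 2 * p.2) / √(p.2 : ℝ)) ^ 2))) * hκG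
  have hRp : κ * √(ρ p) * R p
      = dimerNumberProb p.1 p.2 * √(2 * Real.pi * (2 / 27) * (p.1 : ℝ)) := by
    have h2 : √(9 / 2) * √(ρ p) * √(p.2 : ℝ) = √(p.1 : ℝ) := by
      rw [← Real.sqrt_mul (by norm_num), ← Real.sqrt_mul (by positivity)]
      congr 1
      simp only [hρ]
      field_simp
    rw [Real.sqrt_mul (show 0 ≤ 2 * Real.pi * (2 / 27) by positivity), ← h2]
    simp only [hκ, hR]
    field_simp
  rw [← hRp, ← hGp]
  ring

/-- local central limit theorem for the number of dimers. -/
theorem clt_dimer_number :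
    ∀ C > (0 : ℝ), ∀ ε > (0 : ℝ), ∃ N₀ : ℕ, ∀ N : ℕ, N₀ ≤ N → ∀ s : ℕ,
      ((s : ℝ) - 2 / 9 * (N : ℝ)) / (Real.sqrt (6 * (N : ℝ)) / 9) ∈ Set.Ioo (-C) C →
      |dimerNumberProb N s * Real.sqrt (2 * Real.pi * (2 / 27) * (N : ℝ))
          * Real.exp (((s : ℝ) - 2 / 9 * (N : ℝ)) ^ 2 / (4 / 27 * (N : ℝ)))
        - 1| < ε := by
  intro C _ ε hε
  have h := (tendsto_dimerNumberProb_mul C).eventually (Metric.ball_mem_nhds 1 hε)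
  rw [centralRegime, eventually_inf_principal, eventually_comap] at h
  obtain ⟨N₀, hN₀⟩ := eventually_atTop.1 h
  refine ⟨max N₀ 1, fun N hN s hs => hN₀ N (le_of_max_le_left hN) (N, s) rfl ?_⟩
  have hN0 : (0 : ℝ) < N := by exact_mod_cast le_of_max_le_right hN
  have hσ : 0 < √(6 * (N : ℝ)) / 9 := by positivity
  have := (abs_lt.2 hs).le
  rwa [abs_div, abs_of_pos hσ, div_le_iff₀ hσ] at this
end
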